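/- Counting orthonormal vectors approximable by a family of quantum operations with a total dimension budget. Let n ∈ ℕ, let Δ be a real number with 0 < Δ < 1/(2e), let T be a finite index set, and for each t ∈ T let d_t ≥ 1 be a natural number with ∑_{t∈T} d_t ≤ 2^n and let E_t : M_{d_t}(ℂ) → M_D(ℂ) be a quantum operation. Let (b_w)_{w∈I} be an orthonormal family of vectors in ℂ^D and let L := { w ∈ I : there exist t ∈ T and a density matrix σ ∈ M_{d_t}(ℂ) with ½‖E_t(σ) − P_{b_w}‖₁ ≤ Δ }. Then L is finite and its cardinality satisfies log₂(#L) ≤ n/(1 − 4Δ) + (4Δ/(1 − 4Δ))·log₂(1/Δ), i.e. #L ≤ (2^n·(1/Δ)^{4Δ})^{1/(1−4Δ)}. -/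

import Mathlib

open Matrix
open scoped ComplexOrder

open scoped MatrixOrder in
/-- The trace norm `Tr |A|` of a square complex matrix, where `|A|` is the positive
semidefinite square root of `Aᴴ * A`. -/
noncomputable def traceNorm {n : ℕ} (A : Matrix (Fin n) (Fin n) ℂ) : ℝ :=
  (CFC.sqrt (Aᴴ * A)).trace.re

/-- Trace distance: half the trace norm of the difference. -/
noncomputable def traceDist {n : ℕ} (A B : Matrix (Fin n) (Fin n) ℂ) : ℝ :=
  traceNorm (A - B) / 2

/-- A density matrix: positive semidefinite with trace one. -/
def IsDensityMatrix {n : ℕ} (ρ : Matrix (Fin n) (Fin n) ℂ) : Prop :=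
  ρ.PosSemidef ∧ ρ.trace = 1

/-- The rank-one (outer product) matrix `|ψ⟩⟨ψ|` of a vector. -/
noncomputable def projOf {n : ℕ} (ψ : Fin n → ℂ) : Matrix (Fin n) (Fin n) ℂ :=
  Matrix.vecMulVec ψ (star ψ)

/-- Trace preservation for a linear map between matrix algebras. -/
def IsTracePreserving {d D : ℕ}
    (E : Matrix (Fin d) (Fin d) ℂ →ₗ[ℂ] Matrix (Fin D) (Fin D) ℂ) : Prop :=
  ∀ A, (E A).trace = A.trace

/-- Complete positivity: for every `k`, the map `id_k ⊗ E` on block matrices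
preserves positive semidefiniteness. -/
def IsCompletelyPositive {d D : ℕ}
    (E : Matrix (Fin d) (Fin d) ℂ →ₗ[ℂ] Matrix (Fin D) (Fin D) ℂ) : Prop :=
  ∀ (k : ℕ) (A : Matrix (Fin k × Fin d) (Fin k × Fin d) ℂ), A.PosSemidef →
    (Matrix.of fun p q : Fin k × Fin D =>
      E (Matrix.of fun a b => A (p.1, a) (q.1, b)) p.2 q.2).PosSemidef

/-- **Bessel's inequality** for a positive semidefinite form: the diagonal entries along an
orthonormal family sum up to at most the trace. -/
theorem Matrix.PosSemidef.sum_re_dotProduct_mulVec_le_re_trace {m ι : Type*} [Fintype m]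
    [Fintype ι] [DecidableEq ι] {A : Matrix m m ℂ} (hA : A.PosSemidef) (v : ι → m → ℂ)
    (hv : ∀ i j, star (v i) ⬝ᵥ v j = if i = j then 1 else 0) :
    ∑ i, (star (v i) ⬝ᵥ A *ᵥ v i).re ≤ A.trace.re := by
  classical
  set U : Matrix m ι ℂ := of fun x i => v i x
  have hU : Uᴴ * U = 1 := by
    ext i j
    simpa [U, Matrix.mul_apply, dotProduct, Matrix.one_apply] using hv i j
  have hR : (1 - U * Uᴴ)ᴴ = 1 - U * Uᴴ := by simp
  have hRR : (1 - U * Uᴴ) * (1 - U * Uᴴ) = 1 - U * Uᴴ := by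
    have : U * Uᴴ * (U * Uᴴ) = U * Uᴴ := by
      rw [Matrix.mul_assoc, ← Matrix.mul_assoc Uᴴ, hU, Matrix.one_mul]
    noncomm_ring [this]
  have h := (hA.conjTranspose_mul_mul_same (1 - U * Uᴴ)).trace_nonneg
  have htr : ((1 - U * Uᴴ)ᴴ * A * (1 - U * Uᴴ)).trace = A.trace - (Uᴴ * A * U).trace := by
    rw [hR, Matrix.trace_mul_comm, ← Matrix.mul_assoc, hRR, Matrix.sub_mul, Matrix.trace_sub,
      Matrix.one_mul, Matrix.mul_assoc, Matrix.trace_mul_comm]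
  have hsum : (Uᴴ * A * U).trace = ∑ i, star (v i) ⬝ᵥ A *ᵥ v i := by
    rw [Matrix.trace]
    refine Finset.sum_congr rfl fun i _ => ?_
    rw [Matrix.mul_assoc]
    rfl
  rw [htr, hsum] at h
  simpa using (Complex.le_def.mp h).1

theorem Matrix.PosSemidef.re_dotProduct_mulVec_le_re_trace {m : Type*} [Fintype m]
    {A : Matrix m m ℂ} (hA : A.PosSemidef) {v : m → ℂ} (hv : star v ⬝ᵥ v = 1) :
    (star v ⬝ᵥ A *ᵥ v).re ≤ A.trace.re := by
  simpa using hA.sum_re_dotProduct_mulVec_le_re_trace (fun _ : Unit => v) (by simp [hv])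

open scoped MatrixOrder in
theorem IsDensityMatrix.posSemidef_one_sub {n : ℕ} {ρ : Matrix (Fin n) (Fin n) ℂ}
    (hρ : IsDensityMatrix ρ) : (1 - ρ).PosSemidef := by
  have hH := hρ.1.isHermitian
  have hsum : ∑ i, hH.eigenvalues i = 1 := by
    have h := hH.trace_eq_sum_eigenvalues
    rw [hρ.2] at h
    simpa using (congrArg Complex.re h).symm
  have h : ρ ≤ algebraMap ℝ _ 1 := by
    refine le_algebraMap_of_spectrum_le (fun x hx => ?_) hH
    obtain ⟨i, rfl⟩ := hH.spectrum_real_eq_range_eigenvalues ▸ hx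
    rw [← hsum]
    exact Finset.single_le_sum (fun j _ => hρ.1.eigenvalues_nonneg j) (Finset.mem_univ i)
  simpa using Matrix.le_iff.mp h

theorem re_dotProduct_mulVec_mono {m : Type*} [Fintype m] {A B : Matrix m m ℂ}
    (h : (B - A).PosSemidef) (v : m → ℂ) :
    (star v ⬝ᵥ A *ᵥ v).re ≤ (star v ⬝ᵥ B *ᵥ v).re := by
  have := (Complex.le_def.mp (h.dotProduct_mulVec_nonneg v)).1
  simpa [Matrix.sub_mulVec, dotProduct_sub] using this

open scoped MatrixOrder in
/-- The quadratic form of a Hermitian matrix at a unit vector is at most the trace norm. -/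
theorem Matrix.IsHermitian.re_dotProduct_mulVec_le_traceNorm {n : ℕ}
    {A : Matrix (Fin n) (Fin n) ℂ} (hA : A.IsHermitian) {v : Fin n → ℂ}
    (hv : star v ⬝ᵥ v = 1) : (star v ⬝ᵥ A *ᵥ v).re ≤ traceNorm A := by
  have hle : A ≤ CFC.abs A := by
    rw [← sub_nonneg, CFC.abs_sub_self A hA]
    exact nsmul_nonneg (CFC.negPart_nonneg A) 2
  exact (re_dotProduct_mulVec_mono hle v).trans
    ((CFC.abs_nonneg A).posSemidef.re_dotProduct_mulVec_le_re_trace hv)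

theorem IsCompletelyPositive.map_posSemidef {d D : ℕ}
    {E : Matrix (Fin d) (Fin d) ℂ →ₗ[ℂ] Matrix (Fin D) (Fin D) ℂ}
    (hE : IsCompletelyPositive E) {A : Matrix (Fin d) (Fin d) ℂ} (hA : A.PosSemidef) :
    (E A).PosSemidef :=
  (hE 1 _ (hA.submatrix Prod.snd)).submatrix fun i => ((0 : Fin 1), i)

theorem traceNorm_neg {n : ℕ} (A : Matrix (Fin n) (Fin n) ℂ) : traceNorm (-A) = traceNorm A := by
  simp [traceNorm]

theorem one_sub_two_mul_traceDist_le {n : ℕ} {A : Matrix (Fin n) (Fin n) ℂ}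
    (hA : A.IsHermitian) {v : Fin n → ℂ} (hv : star v ⬝ᵥ v = 1) :
    1 - 2 * traceDist A (projOf v) ≤ (star v ⬝ᵥ A *ᵥ v).re := by
  have hP : (projOf v).IsHermitian := (posSemidef_vecMulVec_self_star v).isHermitian
  have h := (hP.sub hA).re_dotProduct_mulVec_le_traceNorm hv
  rw [← neg_sub A, traceNorm_neg, neg_sub, Matrix.sub_mulVec, dotProduct_sub, projOf,
    Matrix.vecMulVec_mulVec, hv] at h
  simp [hv] at h
  rw [traceDist, projOf]
  linarith

/-- If a vector is close to an output of a quantum operation, then the image of the identity has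
a large expectation at it. -/
theorem one_sub_two_mul_traceDist_le_map_one {d D : ℕ}
    {E : Matrix (Fin d) (Fin d) ℂ →ₗ[ℂ] Matrix (Fin D) (Fin D) ℂ}
    (hE : IsCompletelyPositive E) {σ : Matrix (Fin d) (Fin d) ℂ} (hσ : IsDensityMatrix σ)
    {v : Fin D → ℂ} (hv : star v ⬝ᵥ v = 1) :
    1 - 2 * traceDist (E σ) (projOf v) ≤ (star v ⬝ᵥ E 1 *ᵥ v).re := by
  refine (one_sub_two_mul_traceDist_le (hE.map_posSemidef hσ.1).isHermitian hv).trans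
    (re_dotProduct_mulVec_mono ?_ v)
  rw [← map_sub]
  exact hE.map_posSemidef hσ.posSemidef_one_sub

/-- A cardinality bound `N (1 - 2Δ) ≤ 2 ^ n` implies the logarithmic bound with the weaker
denominator `1 - 4Δ`. -/
theorem logb_two_le_of_mul_le_two_pow {n N : ℕ} {Δ : ℝ} (hΔ0 : 0 < Δ)
    (hΔ1 : Δ < 1 / (2 * Real.exp 1)) (h : N * (1 - 2 * Δ) ≤ 2 ^ n) :
    Real.logb 2 N ≤
      (n : ℝ) / (1 - 4 * Δ) + (4 * Δ / (1 - 4 * Δ)) * Real.logb 2 (1 / Δ) := by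
  have he : (2 : ℝ) < Real.exp 1 := by linarith [Real.exp_one_gt_d9]
  have hinv : Real.exp 1 ≤ 1 / Δ := by
    rw [lt_div_iff₀ (by positivity)] at hΔ1
    rw [le_div_iff₀ hΔ0]
    nlinarith
  have h4 : 0 < 1 - 4 * Δ := by
    rw [lt_div_iff₀ (by positivity)] at hΔ1
    nlinarith
  have hlog : 1 ≤ Real.log (1 / Δ) := by
    rw [Real.le_log_iff_exp_le (by positivity)]
    exact hinv
  have hl2 : 0 < Real.log 2 := Real.log_pos one_lt_two
  have hmain : Real.log N ≤
      (n : ℝ) / (1 - 4 * Δ) * Real.log 2 + (4 * Δ / (1 - 4 * Δ)) * Real.log (1 / Δ) := by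
    rcases N.eq_zero_or_pos with rfl | hN
    · simp only [Nat.cast_zero, Real.log_zero]
      positivity
    have h1 : Real.log N + Real.log (1 - 2 * Δ) ≤ n * Real.log 2 := by
      rw [← Real.log_mul (by positivity) (by linarith), ← Real.log_pow]
      exact Real.log_le_log (mul_pos (by positivity) (by linarith)) h
    have h2 : 1 - (1 - 2 * Δ)⁻¹ ≤ Real.log (1 - 2 * Δ) :=
      Real.one_sub_inv_le_log_of_pos (by linarith)
    have h3 : (1 - 2 * Δ)⁻¹ - 1 ≤ 4 * Δ / (1 - 4 * Δ) := by
      rw [inv_eq_one_div, div_sub_one (by linarith), div_le_div_iff₀ (by linarith) h4]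
      nlinarith
    have h5 : 4 * Δ / (1 - 4 * Δ) ≤ 4 * Δ / (1 - 4 * Δ) * Real.log (1 / Δ) :=
      le_mul_of_one_le_right (by positivity) hlog
    have h6 : (n : ℝ) * Real.log 2 ≤ (n : ℝ) / (1 - 4 * Δ) * Real.log 2 := by
      gcongr
      exact le_div_self (by positivity) h4 (by linarith)
    linarith
  rw [Real.logb, Real.logb, div_le_iff₀ hl2, add_mul, mul_assoc (4 * Δ / _),
    div_mul_cancel₀ _ hl2.ne']
  exact hmain

/-- **Counting orthonormal vectors approximable by a family of quantum operations
with a total dimension budget.** Let `0 < Δ < 1/(2e)`, let `(E_t)_{t ∈ T}` be a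
finite family of quantum operations `M_{d_t}(ℂ) → M_D(ℂ)` with `∑_t d_t ≤ 2^n`, and
let `(b_w)_{w ∈ I}` be an orthonormal family in `ℂ^D`. Then the set `L` of indices
`w` such that `P_{b_w}` is within trace distance `Δ` of the image of some density
matrix under some `E_t` is finite, with
`log₂ #L ≤ n/(1−4Δ) + (4Δ/(1−4Δ)) log₂(1/Δ)`. -/
theorem counting_with_dimension_budget
    (n D : ℕ) (hD : 1 ≤ D)
    (Δ : ℝ) (hΔ0 : 0 < Δ) (hΔ1 : Δ < 1 / (2 * Real.exp 1))
    (T : Type*) [Fintype T] (dt : T → ℕ) (hdt : ∀ t, 1 ≤ dt t)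
    (hbudget : ∑ t, dt t ≤ 2 ^ n)
    (E : ∀ t : T, Matrix (Fin (dt t)) (Fin (dt t)) ℂ →ₗ[ℂ] Matrix (Fin D) (Fin D) ℂ)
    (hCP : ∀ t, IsCompletelyPositive (E t)) (hTP : ∀ t, IsTracePreserving (E t))
    (I : Type*) [DecidableEq I] (b : I → Fin D → ℂ)
    (hortho : ∀ w w', star (b w) ⬝ᵥ b w' = if w = w' then 1 else 0)
    (L : Set I)
    (hL : L = {w : I | ∃ t : T, ∃ σ : Matrix (Fin (dt t)) (Fin (dt t)) ℂ,
      IsDensityMatrix σ ∧ traceDist ((E t) σ) (projOf (b w)) ≤ Δ}) :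
    L.Finite ∧
      Real.logb 2 (Nat.card L) ≤
        (n : ℝ) / (1 - 4 * Δ) + (4 * Δ / (1 - 4 * Δ)) * Real.logb 2 (1 / Δ) := by
  have hone : ∀ w, star (b w) ⬝ᵥ b w = 1 := fun w => by rw [hortho, if_pos rfl]
  have hpos : ∀ t, (E t 1).PosSemidef := fun t => (hCP t).map_posSemidef .one
  have hmem : ∀ w ∈ L, 1 - 2 * Δ ≤ ∑ t, (star (b w) ⬝ᵥ E t 1 *ᵥ b w).re := by
    intro w hw
    rw [hL] at hw
    obtain ⟨t, σ, hσ, hd⟩ := hw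
    calc 1 - 2 * Δ ≤ 1 - 2 * traceDist (E t σ) (projOf (b w)) := by linarith
      _ ≤ (star (b w) ⬝ᵥ E t 1 *ᵥ b w).re :=
        one_sub_two_mul_traceDist_le_map_one (hCP t) hσ (hone w)
      _ ≤ _ := Finset.single_le_sum (f := fun t => (star (b w) ⬝ᵥ E t 1 *ᵥ b w).re)
        (fun t _ => (Complex.le_def.mp ((hpos t).dotProduct_mulVec_nonneg (b w))).1)
        (Finset.mem_univ t)
  have hcard : ∀ F : Finset I, (F : Set I) ⊆ L → F.card * (1 - 2 * Δ) ≤ 2 ^ n := by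
    intro F hF
    calc F.card * (1 - 2 * Δ) = ∑ _w ∈ F, (1 - 2 * Δ) := by rw [Finset.sum_const, nsmul_eq_mul]
      _ ≤ ∑ w ∈ F, ∑ t, (star (b w) ⬝ᵥ E t 1 *ᵥ b w).re :=
        Finset.sum_le_sum fun w hw => hmem w (hF hw)
      _ = ∑ t, ∑ w ∈ F, (star (b w) ⬝ᵥ E t 1 *ᵥ b w).re := Finset.sum_comm
      _ ≤ ∑ t, (dt t : ℝ) := by
        refine Finset.sum_le_sum fun t _ => ?_
        have h := (hpos t).sum_re_dotProduct_mulVec_le_re_trace (fun w : F => b w)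
          fun w w' => by simp only [hortho, Subtype.coe_inj]
        rw [Finset.sum_coe_sort F fun w => (star (b w) ⬝ᵥ E t 1 *ᵥ b w).re, hTP t] at h
        simpa using h
      _ ≤ 2 ^ n := by exact_mod_cast hbudget
  have hΔ2 : 0 < 1 - 2 * Δ := by
    rw [lt_div_iff₀ (by positivity)] at hΔ1
    nlinarith [Real.add_one_lt_exp one_ne_zero]
  have hfin : L.Finite := by
    by_contra hinf
    obtain ⟨k, hk⟩ := exists_nat_gt (2 ^ n / (1 - 2 * Δ))
    obtain ⟨F, hF, rfl⟩ := Set.Infinite.exists_subset_card_eq hinf k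
    rw [div_lt_iff₀ hΔ2] at hk
    exact (hcard F hF).not_gt hk
  refine ⟨hfin, logb_two_le_of_mul_le_two_pow hΔ0 hΔ1 ?_⟩
  rw [Nat.card_coe_set_eq, Set.ncard_eq_toFinset_card L hfin]
  exact hcard _ (by simp)
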